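/- arXiv:1601.03514 — 2 statements merged into one kernel-verified Lean document; each statement's English description precedes it below -/
import Mathlib

section
/- Let f : (X, τ) → (Y, σ) be a surjective closed map that is α^m-irresolute. If (X, τ) is a T_{α^m}-space, then (Y, σ) is a T_{α^m}-space. -/
open Set

/-- A subset `A` is α-open if `A ⊆ int (cl (int A))`. -/
def AlphaOpen {X : Type*} [TopologicalSpace X] (A : Set X) : Prop :=
  A ⊆ interior (closure (interior A))

/-- A subset is α-closed if its complement is α-open. -/
def AlphaClosed {X : Type*} [TopologicalSpace X] (A : Set X) : Prop :=
  AlphaOpen Aᶜ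

/-- A subset `A` is α^m-closed if `int (cl A) ⊆ U` whenever `A ⊆ U` and `U` is α-open. -/
def AlphaMClosed {X : Type*} [TopologicalSpace X] (A : Set X) : Prop :=
  ∀ U : Set X, AlphaOpen U → A ⊆ U → interior (closure A) ⊆ U

/-- A subset is α^m-open if its complement is α^m-closed. -/
def AlphaMOpen {X : Type*} [TopologicalSpace X] (A : Set X) : Prop :=
  AlphaMClosed Aᶜ

/-- A space is a `T_{α^m}`-space if every α^m-closed set is closed. -/
def TAlphaMSpace (X : Type*) [TopologicalSpace X] : Prop :=
  ∀ A : Set X, AlphaMClosed A → IsClosed A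

/-- `f` is α^m-continuous if preimages of closed sets are α^m-closed. -/
def AlphaMContinuous {X Y : Type*} [TopologicalSpace X] [TopologicalSpace Y]
    (f : X → Y) : Prop :=
  ∀ V : Set Y, IsClosed V → AlphaMClosed (f ⁻¹' V)

/-- `f` is α^m-irresolute if preimages of α^m-closed sets are α^m-closed. -/
def AlphaMIrresolute {X Y : Type*} [TopologicalSpace X] [TopologicalSpace Y]
    (f : X → Y) : Prop :=
  ∀ V : Set Y, AlphaMClosed V → AlphaMClosed (f ⁻¹' V)

/-- `f` is an α^m-closed map if images of closed sets are α^m-closed. -/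
def AlphaMClosedMap {X Y : Type*} [TopologicalSpace X] [TopologicalSpace Y]
    (f : X → Y) : Prop :=
  ∀ V : Set X, IsClosed V → AlphaMClosed (f '' V)

/-- `f` is an α^m-open map if images of open sets are α^m-open. -/
def AlphaMOpenMap {X Y : Type*} [TopologicalSpace X] [TopologicalSpace Y]
    (f : X → Y) : Prop :=
  ∀ V : Set X, IsOpen V → AlphaMOpen (f '' V)

theorem stmt_7 {X Y : Type*} [TopologicalSpace X] [TopologicalSpace Y]
    (f : X → Y) (hsurj : Function.Surjective f)
    (hclosed : ∀ V : Set X, IsClosed V → IsClosed (f '' V))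
    (hirr : AlphaMIrresolute f) (hX : TAlphaMSpace X) :
    TAlphaMSpace Y := by
  intro A hA
  rw [← image_preimage_eq A hsurj]
  exact hclosed _ (hX _ (hirr A hA))
end

section
/- If A is an α^m-closed subset of a topological space (X, τ) such that every singleton of X is either α-closed or clopen, then int(cl(A)) ⊆ A, i.e., A is semi-closed. -/
open Set

theorem stmt_10 {X : Type*} [TopologicalSpace X]
    (A : Set X) (hA : AlphaMClosed A)
    (hsing : ∀ x : X, AlphaClosed ({x} : Set X) ∨ IsClopen ({x} : Set X)) :
    interior (closure A) ⊆ A := by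
  intro x hx
  by_contra hxA
  have hsub : A ⊆ ({x} : Set X)ᶜ := subset_compl_singleton_iff.mpr hxA
  rcases hsing x with h | h
  · exact hA _ h hsub hx rfl
  · exact closure_minimal hsub h.compl.isClosed (interior_subset hx) rfl
end
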